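/- arXiv:1804.06435 — 2 statements merged into one kernel-verified Lean document; each statement's English description precedes it below -/
import Mathlib

section
/- Let f be analytic on the unit disk Δ with f(0)=0, f'(0)=1, and suppose Re(z f'(z)/f(z)) > 9(1+α)/(2(3+α)²) for all z ∈ Δ \ {0}, where 0 ≤ α ≤ 1. Then Re(f(z)/z) > (2α² + 3α + 9)/(3(α² + 3α + 6)) for all z ∈ Δ \ {0}. -/
open Filter Topology in
lemma aux_slope (q : ℝ → ℝ) (d : ℝ) (hq : HasDerivAt q d 0) (hneg : ∀ s, 0 < s → q s ≤ 0)
    (h0 : 0 ≤ q 0) : q 0 = 0 ∧ d ≤ 0 := by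
  have hc : Tendsto q (𝓝[>] 0) (𝓝 (q 0)) := hq.continuousAt.tendsto.mono_left nhdsWithin_le_nhds
  have h1 : q 0 ≤ 0 := le_of_tendsto hc (by
    filter_upwards [self_mem_nhdsWithin] with s hs using hneg s hs)
  refine ⟨le_antisymm h1 h0, ?_⟩
  refine le_of_tendsto hq.tendsto_slope_zero_right ?_
  filter_upwards [self_mem_nhdsWithin] with s hs
  have hs : 0 < s := hs
  have := hneg s hs
  have h2 : s⁻¹ > 0 := inv_pos.mpr hs
  simp only [zero_add, smul_eq_mul]
  exact mul_nonpos_of_nonneg_of_nonpos h2.le (by linarith)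

lemma aux_jack (w : ℂ → ℂ) (z d : ℂ) (hw : HasDerivAt w d z) (hz0 : 1 ≤ ‖w z‖)
    (hb : ∀ y : ℂ, ‖y‖ < ‖z‖ → ‖w y‖ ≤ ‖y‖ / ‖z‖) (hz : z ≠ 0) :
    ‖w z‖ = 1 ∧ ∃ k : ℝ, 1 ≤ k ∧ z * d = k * w z := by
  have hzp : 0 < ‖z‖ := norm_pos_iff.mpr hz
  have key : ∀ c : ℝ, ‖w z‖ = 1 ∧
      -((w z).re * (z*d).re + (w z).im * (z*d).im)
        + c * ((w z).im * (z*d).re - (w z).re * (z*d).im) ≤ -1 := by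
    intro c
    have e1 : HasDerivAt (fun s : ℝ => z * Complex.exp ((s:ℂ) * (-1 + c * Complex.I)))
        (z * (-1 + c * Complex.I)) 0 := by
      have := (((Complex.ofRealCLM.hasDerivAt (x := (0:ℝ))).mul_const
        (-1 + c * Complex.I)).cexp).const_mul z
      simpa using this
    have hw' : HasDerivAt w d (z * Complex.exp (((0:ℝ):ℂ) * (-1 + c * Complex.I))) := by
      simpa using hw
    have e2 := hw'.comp (0:ℝ) e1
    have e3 := e2.norm_sq
    have e4 : HasDerivAt (fun s : ℝ => Real.exp (-2 * s)) (-2) 0 := by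
      have := ((hasDerivAt_id (0:ℝ)).const_mul (-2)).exp
      simpa using this
    have := aux_slope _ _ (e3.sub e4) ?_ ?_
    · obtain ⟨h1, h2⟩ := this
      simp at h1 h2
      constructor
      · have : ‖w z‖ ^ 2 = 1 := by linarith
        nlinarith [norm_nonneg (w z)]
      · simp only [Complex.mul_re, Complex.mul_im] at h2 ⊢
        nlinarith
    · intro s hs
      have hn : ‖Complex.exp ((s:ℂ) * (-1 + c * Complex.I))‖ = Real.exp (-s) := by
        rw [Complex.norm_exp]; simp
      have hlt : Real.exp (-s) < 1 := by rw [Real.exp_lt_one_iff]; linarith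
      have := hb (z * Complex.exp ((s:ℂ) * (-1 + c * Complex.I))) (by
        rw [norm_mul, hn]; nlinarith)
      rw [norm_mul, hn, mul_div_cancel_left₀ _ hzp.ne'] at this
      have h3 : Real.exp (-2 * s) = Real.exp (-s) ^ 2 := by
        rw [← Real.exp_nat_mul]; congr 1; push_cast; ring
      simp only [Pi.sub_apply, Function.comp, h3]
      have := pow_le_pow_left₀ (norm_nonneg _) this 2
      linarith
    · simp
      nlinarith
  have h1 := (key 0).1
  have hsq : (w z).re ^ 2 + (w z).im ^ 2 = 1 := by
    have := Complex.sq_norm (w z)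
    rw [h1, Complex.normSq_apply] at this
    nlinarith
  set A := (w z).re * (z*d).re + (w z).im * (z*d).im with hA
  set B := (w z).im * (z*d).re - (w z).re * (z*d).im with hB
  have hA1 : 1 ≤ A := by have := (key 0).2; linarith
  have hB0 : B = 0 := by
    by_contra hne
    have := (key (A / B)).2
    rw [div_mul_cancel₀ _ hne] at this
    linarith
  refine ⟨h1, A, hA1, ?_⟩
  apply Complex.ext
  · rw [Complex.re_ofReal_mul]
    linear_combination (-(z*d).re) * hsq + (w z).im * hB0 - (w z).re * hA - (w z).im * hB
  · rw [Complex.im_ofReal_mul]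
    linear_combination (-(z*d).im) * hsq - (w z).re * hB0 - (w z).im * hA + (w z).re * hB

lemma aux_half (f : ℂ → ℂ)
    (hf : DifferentiableOn ℂ f (Metric.ball 0 1)) (hf0 : f 0 = 0) (hf1 : deriv f 0 = 1)
    (hfne : ∀ z : ℂ, ‖z‖ < 1 → z ≠ 0 → f z ≠ 0)
    (hre : ∀ z : ℂ, ‖z‖ < 1 → z ≠ 0 → (z * deriv f z / f z).re > 1 / 2) :
    ∀ z : ℂ, ‖z‖ < 1 → z ≠ 0 → (f z / z).re > 1 / 2 := by
  have hball : Metric.ball (0:ℂ) 1 ∈ nhds (0:ℂ) := Metric.ball_mem_nhds _ one_pos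
  have hg := (Complex.differentiableOn_dslope hball).mpr hf
  have hgz : ∀ z, z ≠ 0 → dslope f 0 z = f z / z := by
    intro z hz
    rw [dslope_of_ne _ hz, slope_def_field, hf0, sub_zero, sub_zero]
  have hgne : ∀ z ∈ Metric.ball (0:ℂ) 1, dslope f 0 z ≠ 0 := by
    intro z hz
    by_cases h : z = 0
    · subst h; simp [hf1]
    · rw [hgz z h]; exact div_ne_zero (hfne z (by simpa using hz) h) h
  set w : ℂ → ℂ := fun z => 1 - (dslope f 0 z)⁻¹ with hwdef
  have hw : DifferentiableOn ℂ w (Metric.ball 0 1) := (hg.inv hgne).const_sub 1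
  have hw0 : w 0 = 0 := by simp [hwdef, hf1]
  have hwlt : ∀ z : ℂ, ‖z‖ < 1 → ‖w z‖ < 1 := by
    intro z0 hz0
    by_contra hcon
    push Not at hcon
    have hsub : Metric.closedBall (0:ℂ) ‖z0‖ ⊆ Metric.ball 0 1 :=
      Metric.closedBall_subset_ball hz0
    have hcont : ContinuousOn (fun z => ‖w z‖) (Metric.closedBall (0:ℂ) ‖z0‖) :=
      (hw.continuousOn.mono hsub).norm
    have hcl : IsClosed (Metric.closedBall (0:ℂ) ‖z0‖ ∩ (fun z => ‖w z‖) ⁻¹' Set.Ici 1) :=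
      hcont.preimage_isClosed_of_isClosed Metric.isClosed_closedBall isClosed_Ici
    have hcomp := (isCompact_closedBall (0:ℂ) ‖z0‖).of_isClosed_subset hcl Set.inter_subset_left
    obtain ⟨z1, hz1, hmin⟩ := hcomp.exists_isMinOn ⟨z0, by simp, hcon⟩
      (continuous_norm.continuousOn)
    have hz1n : ‖z1‖ ≤ ‖z0‖ := by simpa using hz1.1
    have hz1w : 1 ≤ ‖w z1‖ := hz1.2
    have hz1b : ‖z1‖ < 1 := lt_of_le_of_lt hz1n hz0
    have hz1ne : z1 ≠ 0 := by
      rintro rfl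
      rw [hw0] at hz1w; norm_num at hz1w
    have hsm : ∀ y : ℂ, ‖y‖ < ‖z1‖ → ‖w y‖ ≤ 1 := by
      intro y hy
      by_contra h
      push Not at h
      have : ‖z1‖ ≤ ‖y‖ := hmin ⟨by simpa using (hy.le.trans hz1n), h.le⟩
      linarith
    have hschw : ∀ y : ℂ, ‖y‖ < ‖z1‖ → ‖w y‖ ≤ ‖y‖ / ‖z1‖ := by
      intro y hy
      have := Complex.dist_le_div_mul_dist_of_mapsTo_ball (f := w) (c := 0) (R₁ := ‖z1‖) (R₂ := 1)
        (hw.mono (Metric.ball_subset_ball hz1b.le))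
        (fun x hx => by simpa [hw0] using hsm x (by simpa using hx)) (by simpa using hy)
      rw [hw0, dist_zero_right, dist_zero_right] at this
      rw [div_eq_inv_mul, ← one_div]; exact this
    have hfd : HasDerivAt f (deriv f z1) z1 :=
      (hf.differentiableAt (Metric.isOpen_ball.mem_nhds (by simpa using hz1b))).hasDerivAt
    have hfz := hfne z1 hz1b hz1ne
    have hwv : w z1 = 1 - z1 / f z1 := by simp [hwdef, hgz z1 hz1ne]
    have hwd : HasDerivAt w (-((1 * f z1 - z1 * deriv f z1) / f z1 ^ 2)) z1 := by
      refine HasDerivAt.congr_of_eventuallyEq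
        (((hasDerivAt_id z1).div hfd hfz).const_sub 1) ?_
      filter_upwards [isOpen_ne.mem_nhds hz1ne] with y hy
      simp [hwdef, hgz y hy]
    obtain ⟨hn1, k, hk, hkd⟩ := aux_jack w z1 _ hwd hz1w hschw hz1ne
    have hr := hre z1 hz1b hz1ne
    have hW1 : 1 - w z1 ≠ 0 := by rw [hwv]; simp [hz1ne, hfz]
    have hp : z1 * deriv f z1 / f z1 = 1 + k * (w z1 / (1 - w z1)) := by
      rw [← mul_div_assoc, ← hkd, hwv, sub_sub_cancel]
      field_simp
      ring
    have hns : (w z1).re ^ 2 + (w z1).im ^ 2 = 1 := by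
      have := Complex.sq_norm (w z1)
      rw [hn1, Complex.normSq_apply] at this
      nlinarith
    have hpos : 0 < Complex.normSq (1 - w z1) := Complex.normSq_pos.mpr hW1
    have hhalf : (w z1 / (1 - w z1)).re = -1/2 := by
      rw [Complex.div_re, ← add_div, div_eq_iff hpos.ne', Complex.normSq_apply]
      simp only [Complex.sub_re, Complex.sub_im, Complex.one_re, Complex.one_im]
      linear_combination (-1/2) * hns
    rw [hp, Complex.add_re, Complex.re_ofReal_mul, hhalf, Complex.one_re] at hr
    linarith
  intro z hz hz0
  have h := hwlt z hz
  have hne : f z / z ≠ 0 := div_ne_zero (hfne z hz hz0) hz0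
  have h2 : ‖f z / z - 1‖ < ‖f z / z‖ := by
    have : f z / z - 1 = w z * (f z / z) := by
      simp only [hwdef, hgz z hz0]
      rw [sub_mul, inv_mul_cancel₀ hne, one_mul]
    rw [this, norm_mul]
    have := norm_pos_iff.mpr hne
    nlinarith
  have h3 := pow_lt_pow_left₀ h2 (norm_nonneg _) two_ne_zero
  rw [Complex.sq_norm, Complex.sq_norm, Complex.normSq_apply, Complex.normSq_apply] at h3
  simp only [Complex.sub_re, Complex.sub_im, Complex.one_re, Complex.one_im] at h3
  nlinarith


/-- If f is analytic on the unit disk, f(0)=0, f'(0)=1 and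
    Re(z f'(z)/f(z)) > 9(1+α)/(2(3+α)²) on the punctured disk (0 ≤ α ≤ 1), then
    Re(f(z)/z) > (2α²+3α+9)/(3(α²+3α+6)) on the punctured disk. -/
theorem stmt5 (α : ℝ) (hα1 : 0 ≤ α) (hα2 : α ≤ 1) (f : ℂ → ℂ)
    (hf : DifferentiableOn ℂ f (Metric.ball 0 1)) (hf0 : f 0 = 0) (hf1 : deriv f 0 = 1)
    (hfne : ∀ z : ℂ, ‖z‖ < 1 → z ≠ 0 → f z ≠ 0)
    (hre : ∀ z : ℂ, ‖z‖ < 1 → z ≠ 0 →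
      (z * deriv f z / f z).re > 9 * (1 + α) / (2 * (3 + α) ^ 2)) :
    ∀ z : ℂ, ‖z‖ < 1 → z ≠ 0 →
      (f z / z).re > (2 * α ^ 2 + 3 * α + 9) / (3 * (α ^ 2 + 3 * α + 6)) := by
  intro z hz hz0
  have h1 : (1:ℝ) / 2 ≤ 9 * (1 + α) / (2 * (3 + α) ^ 2) := by
    rw [div_le_div_iff₀ (by norm_num) (by positivity)]
    nlinarith
  have h2 : (2 * α ^ 2 + 3 * α + 9) / (3 * (α ^ 2 + 3 * α + 6)) ≤ (1:ℝ) / 2 := by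
    rw [div_le_div_iff₀ (by positivity) (by norm_num)]
    nlinarith
  have := aux_half f hf hf0 hf1 hfne (fun z hz hz0 => lt_of_le_of_lt h1 (hre z hz hz0)) z hz hz0
  linarith
end

section
/- Let α ∈ (-3,1] and let f ∈ SK(α), i.e., f analytic on the unit disk, f(0)=0, f'(0)=1, and z f'(z)/f(z) ≺ q̃_α(z) (subordination). Define the logarithmic coefficients γ_n by log(f(z)/z) = Σ_{n≥1} 2γ_n z^n. Then Σ_{n≥1} |γ_n|² ≤ (1/(4(3+α)²))·(3π²/2 + 6α·Li₂(-α/3) + α²·Li₂(α²/9)). -/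
/-- q̃_α(z) = 3/(3 + (α-3)z - αz²). -/
noncomputable def qt (α : ℝ) (z : ℂ) : ℂ := 3 / (3 + ((α : ℂ) - 3) * z - (α : ℂ) * z ^ 2)

/-- The dilogarithm Li₂(x) = ∑_{n≥1} x^n/n². -/
noncomputable def Li2 (x : ℝ) : ℝ := ∑' n : ℕ, x ^ (n + 1) / (n + 1) ^ 2

open Complex MeasureTheory Filter Topology

def PSd (F : ℂ → ℂ) (a : ℕ → ℂ) : Prop := ∀ z : ℂ, ‖z‖ < 1 → HasSum (fun n => a n * z ^ n) (F z)

lemma orth_int (n m : ℕ) : ∫ θ in (0:ℝ)..(2 * Real.pi),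
    (exp (θ * I)) ^ n * (starRingEnd ℂ) ((exp (θ * I)) ^ m) = if n = m then 2 * Real.pi else 0 := by
  have h1 : ∀ θ : ℝ, (exp (θ * I)) ^ n * (starRingEnd ℂ) ((exp (θ * I)) ^ m)
      = exp ((((n:ℂ) - m) * I) * θ) := by
    intro θ
    rw [map_pow, ← exp_conj, ← exp_nat_mul, ← exp_nat_mul, ← exp_add]
    congr 1
    simp
    ring
  simp_rw [h1]
  split_ifs with h
  · subst h; simp
  · have hne : ((n:ℂ) - m) ≠ 0 := sub_ne_zero.2 (by exact_mod_cast h)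
    rw [integral_exp_mul_complex (mul_ne_zero hne I_ne_zero)]
    have : exp (((n:ℂ) - m) * I * ((2 * Real.pi : ℝ) : ℂ)) = 1 := by
      rw [exp_eq_one_iff]
      exact ⟨(n:ℤ) - m, by push_cast; ring⟩
    rw [this]; simp

lemma PSd.sumnorm {F : ℂ → ℂ} {a : ℕ → ℂ} (h : PSd F a) {r : ℝ} (h0 : 0 ≤ r) (h1 : r < 1) :
    Summable (fun n => ‖a n‖ * r ^ n) := by
  have := (h (r:ℂ) (by simpa [abs_of_nonneg h0] using h1)).summable.norm
  simpa [abs_of_nonneg h0] using this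

lemma norm_re {r : ℝ} (h0 : 0 ≤ r) (θ : ℝ) : ‖(r:ℂ) * exp (θ * I)‖ = r := by
  rw [norm_mul, norm_exp_ofReal_mul_I]; simp [abs_of_nonneg h0]

lemma cont_circ {F : ℂ → ℂ} (hF : DifferentiableOn ℂ F (Metric.ball 0 1)) {r : ℝ} (h0 : 0 ≤ r)
    (h1 : r < 1) : Continuous (fun θ : ℝ => F (r * exp (θ * I))) := by
  refine hF.continuousOn.comp_continuous (by fun_prop) ?_
  intro θ
  rw [mem_ball_zero_iff, norm_re h0]; exact h1

lemma PSd.coef {F : ℂ → ℂ} {a : ℕ → ℂ} (h : PSd F a) {r : ℝ} (h0 : 0 ≤ r) (h1 : r < 1) (m : ℕ) :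
    ∫ θ in (0:ℝ)..(2 * Real.pi), F (r * exp (θ * I)) * (starRingEnd ℂ) ((exp (θ * I)) ^ m)
      = 2 * Real.pi * (a m * r ^ m) := by
  have key := intervalIntegral.hasSum_integral_of_dominated_convergence (μ := volume)
    (a := 0) (b := 2 * Real.pi)
    (F := fun n (θ : ℝ) => a n * r ^ n * ((exp (θ * I)) ^ n * (starRingEnd ℂ) ((exp (θ * I)) ^ m)))
    (f := fun θ : ℝ => F (r * exp (θ * I)) * (starRingEnd ℂ) ((exp (θ * I)) ^ m))
    (fun n _ => ‖a n‖ * r ^ n) ?_ ?_ ?_ ?_ ?_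
  · refine key.unique ?_
    have h2 : ∀ n, ∫ θ in (0:ℝ)..(2 * Real.pi), a n * r ^ n * ((exp (θ * I)) ^ n *
        (starRingEnd ℂ) ((exp (θ * I)) ^ m)) = if n = m then 2 * Real.pi * (a m * r ^ m) else 0 := by
      intro n
      rw [intervalIntegral.integral_const_mul, orth_int]
      split_ifs with h
      · subst h; push_cast; ring
      · simp
    simp_rw [h2]
    exact hasSum_ite_eq m _
  · intro n
    apply Continuous.aestronglyMeasurable
    fun_prop
  · intro n
    refine Eventually.of_forall fun θ _ => ?_
    simp [norm_exp_ofReal_mul_I, abs_of_nonneg h0]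
  · exact Eventually.of_forall fun θ _ => h.sumnorm h0 h1
  · simp
  · refine Eventually.of_forall fun θ _ => ?_
    have := (h (r * exp (θ * I)) (by rw [norm_re h0]; exact h1)).mul_right
      ((starRingEnd ℂ) ((exp (θ * I)) ^ m))
    refine this.congr_fun ?_ 
    intro n
    ring

lemma PSd.unique {F : ℂ → ℂ} {a b : ℕ → ℂ} (h : PSd F a) (h' : PSd F b) : a = b := by
  funext m
  have h1 := h.coef (r := 1/2) (by norm_num) (by norm_num) m
  have h2 := h'.coef (r := 1/2) (by norm_num) (by norm_num) m
  rw [h1] at h2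
  have hp : (2 * Real.pi : ℂ) ≠ 0 := by simp [Real.pi_ne_zero]
  have h3 := mul_left_cancel₀ hp h2
  exact mul_right_cancel₀ (pow_ne_zero _ (by norm_num)) h3

lemma PSd.parseval {F : ℂ → ℂ} {a : ℕ → ℂ} (h : PSd F a)
    (hF : DifferentiableOn ℂ F (Metric.ball 0 1)) {r : ℝ} (h0 : 0 ≤ r) (h1 : r < 1) :
    HasSum (fun n => 2 * Real.pi * (‖a n‖ ^ 2 * (r ^ n) ^ 2))
      (∫ θ in (0:ℝ)..(2 * Real.pi), ‖F (r * exp (θ * I))‖ ^ 2) := by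
  have hb : ∀ θ : ℝ, ‖F (r * exp (θ * I))‖ ≤ ∑' n, ‖a n‖ * r ^ n := by
    intro θ
    have hs := h (r * exp (θ * I)) (by rw [norm_re h0]; exact h1)
    rw [← hs.tsum_eq]
    have hn : ∀ n, ‖a n * (r * exp (θ * I)) ^ n‖ = ‖a n‖ * r ^ n := by
      intro n; rw [norm_mul, norm_pow, norm_re h0]
    calc _ ≤ ∑' n, ‖a n * (r * exp (θ * I)) ^ n‖ := norm_tsum_le_tsum_norm hs.summable.norm
      _ = _ := by simp_rw [hn]
  have key := intervalIntegral.hasSum_integral_of_dominated_convergence (μ := volume)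
    (a := 0) (b := 2 * Real.pi)
    (F := fun n (θ : ℝ) => a n * r ^ n *
      (starRingEnd ℂ) (F (r * exp (θ * I)) * (starRingEnd ℂ) ((exp (θ * I)) ^ n)))
    (f := fun θ : ℝ => ((‖F (r * exp (θ * I))‖ ^ 2 : ℝ) : ℂ))
    (fun n _ => ‖a n‖ * r ^ n * ∑' n, ‖a n‖ * r ^ n) ?_ ?_ ?_ ?_ ?_
  · rw [intervalIntegral.integral_ofReal] at key
    have h2 : ∀ n, ∫ θ in (0:ℝ)..(2 * Real.pi), a n * r ^ n *
      (starRingEnd ℂ) (F (r * exp (θ * I)) * (starRingEnd ℂ) ((exp (θ * I)) ^ n))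
       = ((2 * Real.pi * (‖a n‖ ^ 2 * (r ^ n) ^ 2) : ℝ) : ℂ) := by
      intro n
      rw [intervalIntegral.integral_const_mul, intervalIntegral.intervalIntegral_conj, h.coef h0 h1]
      push_cast
      rw [← mul_conj' (a n)]
      have h2' : (starRingEnd ℂ) 2 = 2 := map_ofNat _ 2
      simp [h2']
      ring
    simp_rw [h2] at key
    exact_mod_cast key
  · intro n
    apply Continuous.aestronglyMeasurable
    have := cont_circ hF h0 h1
    exact continuous_const.mul (continuous_conj.comp (this.mul (by fun_prop)))
  · intro n
    refine Eventually.of_forall fun θ _ => ?_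
    simp only [norm_mul, norm_pow, norm_real, RCLike.norm_conj, norm_exp_ofReal_mul_I, one_pow,
      mul_one, Real.norm_of_nonneg h0]
    gcongr
    exact hb θ
  · exact Eventually.of_forall fun θ _ => (h.sumnorm h0 h1).mul_right _
  · simp
  · refine Eventually.of_forall fun θ _ => ?_
    have := (h (r * exp (θ * I)) (by rw [norm_re h0]; exact h1)).mul_right
      ((starRingEnd ℂ) (F (r * exp (θ * I))))
    rw [mul_conj'] at this
    push_cast
    refine this.congr_fun ?_ 
    intro n
    simp
    ring

lemma PSd.mul {F G : ℂ → ℂ} {a b : ℕ → ℂ} (h : PSd F a) (h' : PSd G b) :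
    PSd (fun z => F z * G z) (fun n => ∑ k ∈ Finset.range (n + 1), a k * b (n - k)) := by
  intro z hz
  have := hasSum_sum_range_mul_of_summable_norm (h z hz).summable.norm (h' z hz).summable.norm
  rw [(h z hz).tsum_eq, (h' z hz).tsum_eq] at this
  refine this.congr_fun ?_
  intro n
  rw [Finset.sum_mul]
  refine Finset.sum_congr rfl fun k hk => ?_
  have : z ^ n = z ^ k * z ^ (n - k) := by
    rw [← pow_add]; congr 1; have := Finset.mem_range.1 hk; omega
  rw [this]; ring

lemma exists_PSd {F : ℂ → ℂ} (hF : DifferentiableOn ℂ F (Metric.ball 0 1)) :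
    PSd F (fun n => (n.factorial : ℂ)⁻¹ * iteratedDeriv n F 0) := by
  intro z hz
  have := hasSum_taylorSeries_on_ball (z := z) hF (by simpa using hz)
  refine this.congr_fun ?_
  intro n
  simp; ring

lemma trunc_contr {φ H : ℂ → ℂ} {h c : ℕ → ℂ} (hφ : DifferentiableOn ℂ φ (Metric.ball 0 1))
    (hφ1 : ∀ z : ℂ, ‖z‖ < 1 → ‖φ z‖ ≤ 1) (hH : PSd H h) (hc : PSd (fun z => φ z * H z) c) (m : ℕ) :
    ∑ k ∈ Finset.range m, ‖c k‖ ^ 2 ≤ ∑ k ∈ Finset.range m, ‖h k‖ ^ 2 := by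
  set P : ℂ → ℂ := fun z => ∑ k ∈ Finset.range m, h k * z ^ k with hP
  set p : ℕ → ℂ := fun k => if k < m then h k else 0 with hp
  have hPd : DifferentiableOn ℂ P (Metric.ball 0 1) := by
    apply Differentiable.differentiableOn; fun_prop
  have hPs : PSd P p := by
    intro z hz
    have : P z = ∑ k ∈ Finset.range m, p k * z ^ k := by
      refine Finset.sum_congr rfl fun k hk => ?_
      simp [hp, Finset.mem_range.1 hk]
    rw [this]
    refine hasSum_sum_of_ne_finset_zero fun k hk => ?_
    simp [hp] at hk ⊢
    intro h; omega
  have hφs := exists_PSd hφ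
  have e1 := hc.unique (hφs.mul hH)
  have e2 := hφs.mul hPs
  set d := (fun n => ∑ k ∈ Finset.range (n + 1),
    ((k.factorial : ℂ)⁻¹ * iteratedDeriv k φ 0) * p (n - k)) with hd
  have e3 : ∀ n < m, c n = d n := by
    intro n hn
    rw [e1]
    refine Finset.sum_congr rfl fun k hk => ?_
    simp only [hp]
    rw [if_pos (by omega)]
  have key : ∀ r : ℝ, 0 ≤ r → r < 1 →
      ∑ k ∈ Finset.range m, ‖c k‖ ^ 2 * (r ^ k) ^ 2 ≤ ∑ k ∈ Finset.range m, ‖h k‖ ^ 2 := by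
    intro r h0 h1
    have A := e2.parseval (hφ.mul hPd) h0 h1
    have B := hPs.parseval hPd h0 h1
    have C : (∫ θ in (0:ℝ)..(2 * Real.pi), ‖φ (r * exp (θ * I)) * P (r * exp (θ * I))‖ ^ 2)
        ≤ ∫ θ in (0:ℝ)..(2 * Real.pi), ‖P (r * exp (θ * I))‖ ^ 2 := by
      have c1 := cont_circ hφ h0 h1
      have c2 := cont_circ hPd h0 h1
      apply intervalIntegral.integral_mono_on (by positivity)
      · exact ((c1.mul c2).norm.pow 2).intervalIntegrable _ _
      · exact (c2.norm.pow 2).intervalIntegrable _ _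
      · intro θ _
        rw [norm_mul]
        have := hφ1 (r * exp (θ * I)) (by rw [norm_re h0]; exact h1)
        gcongr
        exact mul_le_of_le_one_left (norm_nonneg _) this
    have A' := sum_le_hasSum (Finset.range m) (fun i _ => by positivity) A
    have B' : HasSum (fun n => 2 * Real.pi * (‖p n‖ ^ 2 * (r ^ n) ^ 2))
      (∑ n ∈ Finset.range m, 2 * Real.pi * (‖p n‖ ^ 2 * (r ^ n) ^ 2)) := by
      refine hasSum_sum_of_ne_finset_zero fun k hk => ?_
      simp [hp] at hk ⊢
      left; intro h; omega
    have D := A'.trans (C.trans (B.unique B').le)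
    rw [← Finset.mul_sum, ← Finset.mul_sum] at D
    have E := le_of_mul_le_mul_left D (by positivity)
    calc _ = ∑ k ∈ Finset.range m, ‖d k‖ ^ 2 * (r ^ k) ^ 2 :=
          Finset.sum_congr rfl fun k hk => by rw [e3 k (Finset.mem_range.1 hk)]
      _ ≤ _ := E
      _ ≤ _ := Finset.sum_le_sum fun k hk => by
          simp only [hp, if_pos (Finset.mem_range.1 hk)]
          apply mul_le_of_le_one_right (by positivity)
          exact pow_le_one₀ (by positivity) (pow_le_one₀ h0 h1.le)
  have hcont : Continuous (fun r : ℝ => ∑ k ∈ Finset.range m, ‖c k‖ ^ 2 * (r ^ k) ^ 2) := by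
    fun_prop
  have ht : Tendsto (fun r : ℝ => ∑ k ∈ Finset.range m, ‖c k‖ ^ 2 * (r ^ k) ^ 2) (𝓝[<] 1)
      (𝓝 (∑ k ∈ Finset.range m, ‖c k‖ ^ 2)) := by
    have := (hcont.tendsto 1).mono_left (nhdsWithin_le_nhds (s := Set.Iio 1))
    simpa using this
  refine le_of_tendsto ht ?_
  filter_upwards [Ioo_mem_nhdsLT (show (0:ℝ) < 1 by norm_num)] with r hr
  exact key r hr.1.le hr.2

lemma rogos {w : ℂ → ℂ} (hw : DifferentiableOn ℂ w (Metric.ball 0 1)) (hw0 : w 0 = 0)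
    (hwb : ∀ z : ℂ, ‖z‖ < 1 → ‖w z‖ < 1) (G : ℕ → ℂ → ℂ) (B : ℕ → ℂ)
    (hG : ∀ k, DifferentiableOn ℂ (G k) (Metric.ball 0 1))
    (hrec : ∀ k u, ‖u‖ < 1 → G k u = B k + u * G (k + 1) u) (n : ℕ) :
    ∀ k c, PSd (fun z => G k (w z)) c →
      ∑ j ∈ Finset.range n, ‖c j‖ ^ 2 ≤ ∑ j ∈ Finset.range n, ‖B (k + j)‖ ^ 2 := by
  induction n with
  | zero => intro k c _; simp
  | succ n ih =>
    intro k c hc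
    have hφ : DifferentiableOn ℂ (dslope w 0) (Metric.ball 0 1) :=
      (differentiableOn_dslope (Metric.ball_mem_nhds _ one_pos)).2 hw
    have hφ1 : ∀ z : ℂ, ‖z‖ < 1 → ‖dslope w 0 z‖ ≤ 1 := by
      intro z hz
      have := norm_dslope_le_div_of_mapsTo_ball (R₂ := 1) hw (fun y hy => by
        rw [hw0]; simpa using (hwb y (by simpa using hy)).le) (z := z) (by simpa using hz)
      simpa using this
    have hwφ : ∀ z, w z = z * dslope w 0 z := by
      intro z
      have := sub_smul_dslope w 0 z
      simpa [hw0] using this.symm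
    have hcomp : DifferentiableOn ℂ (fun z => G (k + 1) (w z)) (Metric.ball 0 1) :=
      (hG (k + 1)).comp hw fun z hz => by simpa using hwb z (by simpa using hz)
    have hd := exists_PSd hcomp
    have he := exists_PSd (hφ.mul hcomp)
    set d := (fun n : ℕ => (n.factorial : ℂ)⁻¹ * iteratedDeriv n (fun z => G (k + 1) (w z)) 0)
    generalize (fun n : ℕ => (n.factorial : ℂ)⁻¹ * iteratedDeriv n (_ : ℂ → ℂ) 0) = e at he
    have hc' : PSd (fun z => G k (w z)) (fun n => Nat.casesOn n (B k) e) := by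
      intro z hz
      rw [← hasSum_nat_add_iff' 1]
      have := (he z hz).mul_left z
      simp only [Finset.sum_range_one, pow_zero, mul_one]
      have h3 : G k (w z) - B k = z * (dslope w 0 * fun z => G (k + 1) (w z)) z := by
        rw [hrec k (w z) (hwb z hz), add_sub_cancel_left]
        simp only [Pi.mul_apply]
        rw [← mul_assoc, ← hwφ z]
      change HasSum _ (G k (w z) - B k)
      rw [h3]
      refine this.congr_fun ?_
      intro j
      simp only [pow_succ]; ring
    rw [hc.unique hc', Finset.sum_range_succ', Finset.sum_range_succ' (fun j => ‖B (k + j)‖ ^ 2)]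
    have h1 := trunc_contr hφ hφ1 hd he n
    have h2 := ih (k + 1) d hd
    simp only [add_zero]
    refine add_le_add ?_ le_rfl
    refine h1.trans (h2.trans (le_of_eq ?_))
    refine Finset.sum_congr rfl fun j _ => ?_
    rw [show k + 1 + j = k + (j + 1) by ring]

lemma abel_le (x y v : ℕ → ℝ) (hv : Antitone v) (hv0 : ∀ n, 0 ≤ v n)
    (h : ∀ n, ∑ j ∈ Finset.range n, x j ≤ ∑ j ∈ Finset.range n, y j) (n : ℕ) :
    ∑ j ∈ Finset.range n, v j * x j ≤ ∑ j ∈ Finset.range n, v j * y j := by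
  have : ∀ n, v n * (∑ j ∈ Finset.range n, y j - ∑ j ∈ Finset.range n, x j) ≤
      ∑ j ∈ Finset.range n, v j * y j - ∑ j ∈ Finset.range n, v j * x j := by
    intro n
    induction n with
    | zero => simp
    | succ n ih =>
      have h1 := h (n + 1)
      have h2 := hv (Nat.le_succ n)
      have h3 := mul_le_mul_of_nonneg_right h2 (sub_nonneg.2 h1)
      refine h3.trans ?_
      simp only [Finset.sum_range_succ]
      linarith
  have h1 := this n
  have h2 := mul_nonneg (hv0 n) (sub_nonneg.2 (h n))
  linarith

/-- If f ∈ SK(α) (z f'/f subordinate to q̃_α) with logarithmic coefficients γ_n, then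
    ∑ |γ_n|² ≤ (1/(4(3+α)²))(3π²/2 + 6α Li₂(-α/3) + α² Li₂(α²/9)). -/
theorem stmt10 (α : ℝ) (hα1 : -3 < α) (hα2 : α ≤ 1) (f w g : ℂ → ℂ) (γ : ℕ → ℂ)
    (hf : DifferentiableOn ℂ f (Metric.ball 0 1)) (hf0 : f 0 = 0) (hf1 : deriv f 0 = 1)
    (hfne : ∀ z : ℂ, ‖z‖ < 1 → z ≠ 0 → f z ≠ 0)
    (hw : DifferentiableOn ℂ w (Metric.ball 0 1)) (hw0 : w 0 = 0)
    (hwb : ∀ z : ℂ, ‖z‖ < 1 → ‖w z‖ < 1)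
    (hsub : ∀ z : ℂ, ‖z‖ < 1 → z ≠ 0 → z * deriv f z / f z = qt α (w z))
    (hg : DifferentiableOn ℂ g (Metric.ball 0 1)) (hg0 : g 0 = 0)
    (hexp : ∀ z : ℂ, ‖z‖ < 1 → z ≠ 0 → Complex.exp (g z) = f z / z)
    (hγ : ∀ z : ℂ, ‖z‖ < 1 → HasSum (fun n : ℕ => 2 * γ (n + 1) * z ^ (n + 1)) (g z)) :
    Summable (fun n : ℕ => ‖γ (n + 1)‖ ^ 2) ∧
    ∑' n : ℕ, ‖γ (n + 1)‖ ^ 2 ≤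
      1 / (4 * (3 + α) ^ 2) *
        (3 * Real.pi ^ 2 / 2 + 6 * α * Li2 (-α / 3) + α ^ 2 * Li2 (α ^ 2 / 9)) := by
  have h3 : (0:ℝ) < 3 + α := by linarith
  have h3c : (3 + α : ℂ) ≠ 0 := by exact_mod_cast h3.ne'
  set x : ℝ := -α / 3 with hx
  have hx1 : |x| < 1 := by rw [abs_lt]; constructor <;> simp only [hx] <;> linarith
  set G : ℕ → ℂ → ℂ := fun k u => (3 / (3 + α)) / (1 - u) + (α / (3 + α)) * x ^ k / (1 - x * u)
    with hG
  set B : ℕ → ℂ := fun k => 3 / (3 + α) + (α / (3 + α)) * x ^ k with hB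
  have n1 : ∀ u : ℂ, ‖u‖ < 1 → 1 - u ≠ 0 := by
    intro u hu h
    rw [← sub_eq_zero.1 h] at hu; simp at hu
  have n2 : ∀ u : ℂ, ‖u‖ < 1 → 1 - x * u ≠ 0 := by
    intro u hu
    apply n1
    rw [norm_mul, norm_real, Real.norm_eq_abs]
    exact mul_lt_one_of_nonneg_of_lt_one_left (abs_nonneg _) hx1 hu.le
  have hGd : ∀ k, DifferentiableOn ℂ (G k) (Metric.ball 0 1) := by
    intro k u hu
    have hu' : ‖u‖ < 1 := by simpa using hu
    apply DifferentiableAt.differentiableWithinAt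
    have m1 := n1 u hu'
    have m2 := n2 u hu'
    simp only [hG]
    fun_prop (disch := assumption)
  have hrec : ∀ k u, ‖u‖ < 1 → G k u = B k + u * G (k + 1) u := by
    intro k u hu
    have m1 := n1 u hu
    have m2 := n2 u hu
    simp only [hG, hB]
    have e1 : ∀ a t : ℂ, 1 - t ≠ 0 → a / (1 - t) = a + t * a / (1 - t) := by
      intro a t ht
      field_simp
      ring
    rw [pow_succ]
    linear_combination e1 (3 / (3 + α)) u m1 + e1 (α / (3 + α) * x ^ k) (x * u) m2
  have hG0 : ∀ u, ‖u‖ < 1 → G 0 u = qt α u := by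
    intro u hu
    have m1 := n1 u hu
    have m2 := n2 u hu
    have hxc : (x : ℂ) = -α / 3 := by simp [hx]
    have m3 : (3 + α * u : ℂ) ≠ 0 := by
      intro h; apply m2; rw [hxc]; linear_combination h / 3
    have m4 : (1 - -(α:ℂ) / 3 * u) = (3 + α * u) / 3 := by ring
    have m5 : (3 + ((α : ℂ) - 3) * u - (α : ℂ) * u ^ 2) = (1 - u) * (3 + α * u) := by ring
    simp only [hG, qt]
    rw [hxc, m4, m5]
    field_simp
    ring
  have hB0 : B 0 = 1 := by simp only [hB]; field_simp
  -- power series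
  have hgs : PSd g (fun n => Nat.casesOn n 0 (fun m => 2 * γ (m + 1))) := by
    intro z hz
    rw [← hasSum_nat_add_iff' 1]
    simpa using hγ z hz
  have hg' : DifferentiableOn ℂ (deriv g) (Metric.ball 0 1) := hg.deriv Metric.isOpen_ball
  have eg := hgs.unique (exists_PSd hg)
  have hds : PSd (deriv g) (fun n => (n + 1) * (2 * γ (n + 1))) := by
    have := exists_PSd hg'
    convert this using 2 with n
    have e := congrFun eg (n + 1)
    simp only at e
    rw [e, iteratedDeriv_succ', Nat.factorial_succ]
    have : (n.factorial : ℂ) ≠ 0 := by exact_mod_cast n.factorial_ne_zero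
    have : (n + 1 : ℂ) ≠ 0 := by exact_mod_cast n.succ_ne_zero
    push_cast
    field_simp
  have hrel : ∀ z : ℂ, ‖z‖ < 1 → G 0 (w z) - 1 = z * deriv g z := by
    intro z hz
    by_cases hz0 : z = 0
    · subst hz0
      rw [hw0, hrec 0 0 (by simp), hB0]; simp
    · rw [hG0 _ (hwb z hz), ← hsub z hz hz0]
      have hzb : Metric.ball (0:ℂ) 1 ∈ 𝓝 z := Metric.isOpen_ball.mem_nhds (by simpa using hz)
      have d1 := ((hg.differentiableAt hzb).hasDerivAt).cexp
      have d2 := ((hf.differentiableAt hzb).hasDerivAt).div (hasDerivAt_id z) hz0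
      have ev : (fun y => exp (g y)) =ᶠ[𝓝 z] (f / id) := by
        filter_upwards [hzb, isOpen_ne.mem_nhds hz0] with y hy hy0
        exact hexp y (by simpa using hy) hy0
      have d3 := d1.unique (d2.congr_of_eventuallyEq ev)
      rw [hexp z hz hz0] at d3
      have hfz := hfne z hz hz0
      simp only [id] at d3
      field_simp at d3 ⊢
      linear_combination -d3
  have hcs : PSd (fun z => G 0 (w z)) (fun n => Nat.casesOn n 1 (fun m => (m + 1) * (2 * γ (m + 1)))) := by
    intro z hz
    rw [← hasSum_nat_add_iff' 1]
    simp only [Finset.sum_range_one, pow_zero, mul_one]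
    change HasSum _ (G 0 (w z) - 1)
    rw [hrel z hz]
    refine ((hds z hz).mul_left z).congr_fun ?_
    intro n
    simp only [pow_succ]; ring
  have hpart : ∀ n, ∑ j ∈ Finset.range n, ‖((j:ℂ) + 1) * (2 * γ (j + 1))‖ ^ 2 ≤
      ∑ j ∈ Finset.range n, ‖B (j + 1)‖ ^ 2 := by
    intro n
    have := rogos hw hw0 hwb G B hGd hrec (n + 1) 0 _ hcs
    rw [Finset.sum_range_succ', Finset.sum_range_succ'] at this
    simpa [hB0] using this
  have hab := abel_le _ _ (fun n : ℕ => 1 / (4 * ((n:ℝ) + 1) ^ 2))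
    (by
      intro a b hab
      have : (a:ℝ) ≤ b := by exact_mod_cast hab
      simp only
      gcongr) (fun n => by positivity) hpart
  have t1 : ∀ j : ℕ, 1 / (4 * ((j:ℝ) + 1) ^ 2) * ‖((j:ℂ) + 1) * (2 * γ (j + 1))‖ ^ 2
      = ‖γ (j + 1)‖ ^ 2 := by
    intro j
    have : ‖(j:ℂ) + 1‖ = (j:ℝ) + 1 := by
      have := Complex.norm_natCast (j + 1); push_cast at this; exact this
    rw [norm_mul, norm_mul, this]
    have : (j:ℝ) + 1 ≠ 0 := by positivity
    simp
    field_simp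
    ring
  have t2 : ∀ j : ℕ, 1 / (4 * ((j:ℝ) + 1) ^ 2) * ‖B (j + 1)‖ ^ 2
      = 1 / (4 * (3 + α) ^ 2) * (9 * (1 / ((j + 1 : ℕ) : ℝ) ^ 2) + 6 * α * (x ^ (j + 1) / (j + 1) ^ 2)
        + α ^ 2 * ((α ^ 2 / 9) ^ (j + 1) / (j + 1) ^ 2)) := by
    intro j
    have hBr : B (j + 1) = (((3 + α * x ^ (j + 1)) / (3 + α) : ℝ) : ℂ) := by
      simp only [hB]; push_cast; ring
    have hsq : α ^ 2 / 9 = x ^ 2 := by rw [hx]; ring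
    have : (j:ℝ) + 1 ≠ 0 := by positivity
    rw [hBr, norm_real, Real.norm_eq_abs, sq_abs, hsq, ← pow_mul, mul_comm 2, pow_mul]
    generalize x ^ (j + 1) = y
    push_cast
    field_simp
    ring
  have sli : ∀ y : ℝ, |y| < 1 → HasSum (fun n : ℕ => y ^ (n + 1) / ((n:ℝ) + 1) ^ 2) (Li2 y) := by
    intro y hy
    apply Summable.hasSum
    have hs := summable_geometric_of_lt_one (abs_nonneg y) hy
    refine Summable.of_norm_bounded hs fun n => ?_
    rw [norm_div, norm_pow, Real.norm_eq_abs, pow_succ]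
    apply (div_le_self (by positivity) _).trans
    · exact mul_le_of_le_one_right (by positivity) hy.le
    · rw [Real.norm_of_nonneg (by positivity)]
      have : (0:ℝ) ≤ n := by positivity
      nlinarith
  have hx2 : |α ^ 2 / 9| < 1 := by
    have : α ^ 2 / 9 = x ^ 2 := by rw [hx]; ring
    rw [this, abs_pow]
    exact pow_lt_one₀ (abs_nonneg _) hx1 (by norm_num)
  have hz2 : HasSum (fun n : ℕ => (1:ℝ) / ((n + 1 : ℕ) : ℝ) ^ 2) (Real.pi ^ 2 / 6) := by
    have := (hasSum_nat_add_iff' 1).2 hasSum_zeta_two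
    simpa using this
  have htot := ((((hz2.mul_left 9).add ((sli x hx1).mul_left (6 * α))).add
    ((sli _ hx2).mul_left (α ^ 2))).mul_left (1 / (4 * (3 + α) ^ 2)))
  have hbd : ∀ n, ∑ j ∈ Finset.range n, ‖γ (j + 1)‖ ^ 2 ≤ 1 / (4 * (3 + α) ^ 2) *
        (3 * Real.pi ^ 2 / 2 + 6 * α * Li2 x + α ^ 2 * Li2 (α ^ 2 / 9)) := by
    intro n
    have := hab n
    simp only [t1] at this
    refine this.trans ?_
    have hh := sum_le_hasSum (Finset.range n) (fun j _ => by rw [← t2]; positivity) htot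
    simp only [t2]
    refine hh.trans (le_of_eq ?_)
    ring
  exact ⟨summable_of_sum_range_le (fun n => by positivity) hbd,
    Real.tsum_le_of_sum_range_le (fun n => by positivity) hbd⟩
end
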